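/- Let α be a type and let K be a finite set of lists over α with cardinality k ≥ 1. Then the set K ∪ { lcp x y | x ∈ K, y ∈ K, x ≠ y } has cardinality at most 2k - 1. (This is the precise form of the paper's assertion that its trie data structure on k keywords contains O(k) nodes in total, rather than O(n) nodes where n is the total length of the keywords.) -/

import Mathlib

/-- The longest common prefix of two lists: the unique common prefix of `x` and
`y` of which every common prefix of `x` and `y` is a prefix; equivalently,
`x.take m` where `m` is the largest `n` with `x.take n = y.take n`. -/
def lcp {α : Type*} [DecidableEq α] : List α → List α → List α
  | a :: x, b :: y => if a = b then a :: lcp x y else []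
  | _, _ => []

theorem lcp_comm {α : Type*} [DecidableEq α] (x y : List α) : lcp x y = lcp y x := by
  induction x generalizing y with
  | nil => cases y <;> simp [lcp]
  | cons a x ih =>
    cases y with
    | nil => simp [lcp]
    | cons b y => grind [lcp]

/-- If `z` shares at least as much with `y` as with `x`, then `lcp z x` is one of `lcp z y` and
`lcp y x`. -/
theorem lcp_eq_or_eq_of_length_le {α : Type*} [DecidableEq α] (x y z : List α)
    (h : (lcp z x).length ≤ (lcp z y).length) : lcp z x = lcp z y ∨ lcp z x = lcp y x := by
  induction z generalizing x y with
  | nil => simp [lcp]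
  | cons c z ih =>
    cases x with
    | nil => cases y <;> simp [lcp]
    | cons a x =>
      cases y with
      | nil => simp_all [lcp]
      | cons b y => grind [lcp]

/-- A finite set `K` of `k ≥ 1` lists together with the longest common prefixes
of its distinct pairs has cardinality at most `2k - 1`. -/
theorem card_nodes_le (α : Type*) [DecidableEq α] (K : Finset (List α))
    (hK : 1 ≤ K.card) :
    (K ∪ ((K ×ˢ K).filter fun p => p.1 ≠ p.2).image fun p => lcp p.1 p.2).card ≤
      2 * K.card - 1 := by
  have hne : K.Nonempty := Finset.card_pos.mp hK
  clear hK
  induction hne using Finset.Nonempty.cons_induction with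
  | singleton a =>
    have : (({a} ×ˢ {a} : Finset (List α × List α)).filter fun p => p.1 ≠ p.2) = ∅ := by
      ext ⟨x, y⟩
      simp only [Finset.mem_filter, Finset.mem_product, Finset.mem_singleton]
      grind
    simp [this]
  | cons z K hz hne ih =>
    obtain ⟨y, hy, hmax⟩ := K.exists_max_image (fun x => (lcp z x).length) hne
    set N := K ∪ ((K ×ˢ K).filter fun p => p.1 ≠ p.2).image fun p => lcp p.1 p.2 with hN
    have hpair : ∀ u ∈ K, ∀ v ∈ K, u ≠ v → lcp u v ∈ N := fun u hu v hv huv =>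
      Finset.mem_union_right _ (Finset.mem_image.mpr
        ⟨(u, v), Finset.mem_filter.mpr ⟨Finset.mk_mem_product hu hv, huv⟩, rfl⟩)
    have hnew : ∀ x ∈ K, lcp z x ∈ insert z (insert (lcp z y) N) := by
      intro x hx
      by_cases hxy : y = x
      · simp [hxy]
      · rcases lcp_eq_or_eq_of_length_le x y z (hmax x hx) with h | h
        · simp [h]
        · simp [h, hpair y hy x hx hxy]
    have hsub : (Finset.cons z K hz ∪ ((Finset.cons z K hz ×ˢ Finset.cons z K hz).filter
        fun p => p.1 ≠ p.2).image fun p => lcp p.1 p.2) ⊆ insert z (insert (lcp z y) N) := by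
      refine Finset.union_subset (fun x hx => ?_) (Finset.image_subset_iff.mpr ?_)
      · rcases Finset.mem_cons.mp hx with rfl | hx
        · simp
        · simp [hN, hx]
      · rintro ⟨u, v⟩ huv
        simp only [Finset.mem_filter, Finset.mem_product, Finset.mem_cons] at huv
        obtain ⟨⟨rfl | hu, rfl | hv⟩, hne'⟩ := huv
        · exact absurd rfl hne'
        · exact hnew v hv
        · exact lcp_comm v u ▸ hnew u hu
        · simp [hpair u hu v hv hne']
    have hcard := Finset.card_le_card hsub
    have h₁ := Finset.card_insert_le z (insert (lcp z y) N)
    have h₂ := Finset.card_insert_le (lcp z y) N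
    have hpos := hne.card_pos
    rw [Finset.card_cons]
    omega
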